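/- arXiv:1309.2682 — 2 statements merged into one kernel-verified Lean document; each statement's English description precedes it below -/
import Mathlib

section
/- For each integer n ≥ 2203, the system T′ of equations in the variables x_1,...,x_{n+11} consisting of: x_i · x_i = x_{i+1} for all i ∈ {1,...,n}; x_{n+2} + x_{n+2} = x_{n+3}; x_{n+3} + x_{n+3} = x_{n+4}; x_{n+4} + x_{n+2} = x_{n+5}; x_{n+6} · x_i = x_i for all i ∈ {1,...,n+11}; x_{n+5} + x_{n+6} = x_{n+7}; x_{n+7} + x_{n+6} = x_{n+8}; x_{n+8} + x_{n+6} = x_1; x_{n+8} · x_{n+8} = x_{n+9}; x_{n+9} · x_{n+10} = x_{n+11}; x_{n+11} + x_1 = x_{2204}, has exactly two solutions in integers: the zero tuple (0,...,0), and a tuple (a_1,...,a_{n+11}) of positive integers with max(a_1,...,a_{n+11}) > 2^(2^(n+11)). In particular, T′ contains only equations of the form x_i + x_j = x_k or x_i · x_j = x_k, so for m = n + 11 ≥ 2214 there exists a system S ⊆ {x_i + x_j = x_k, x_i · x_j = x_k : i, j, k ∈ {1,...,m}} with only finitely many integer solutions, one of which has maximum exceeding 2^(2^m). -/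
/-- The modified system `T'`, in variables `x 1, ..., x (n+11)` over ℤ, where the
equation `x (n+6) = 1` is replaced by the equations `x (n+6) * x i = x i` for all
`i ∈ {1, ..., n+11}`. -/
def SolvesT' (n : ℕ) (x : ℕ → ℤ) : Prop :=
  (∀ i, 1 ≤ i → i ≤ n → x i * x i = x (i + 1)) ∧
  x (n + 2) + x (n + 2) = x (n + 3) ∧
  x (n + 3) + x (n + 3) = x (n + 4) ∧
  x (n + 4) + x (n + 2) = x (n + 5) ∧
  (∀ i, 1 ≤ i → i ≤ n + 11 → x (n + 6) * x i = x i) ∧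
  x (n + 5) + x (n + 6) = x (n + 7) ∧
  x (n + 7) + x (n + 6) = x (n + 8) ∧
  x (n + 8) + x (n + 6) = x 1 ∧
  x (n + 8) * x (n + 8) = x (n + 9) ∧
  x (n + 9) * x (n + 10) = x (n + 11) ∧
  x (n + 11) + x 1 = x 2204

/-- Equations of the form `x i + x j = x k` or `x i * x j = x k` in `m` variables. -/
inductive AMEqn (m : ℕ) where
  | add (i j k : Fin m)
  | mul (i j k : Fin m)

/-- An integer tuple satisfies a single equation. -/
def AMEqn.Holds {m : ℕ} (x : Fin m → ℤ) : AMEqn m → Prop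
  | .add i j k => x i + x j = x k
  | .mul i j k => x i * x j = x k

theorem prime_2203 : Nat.Prime (2 ^ 2203 - 1) :=
  lucas_lehmer_sufficiency 2203 (by norm_num) (by norm_num)

set_option exponentiation.threshold 3000 in
theorem exists_p : ∃ p : ℕ, p.Prime ∧ 2 ^ 2203 = p + 1 ∧ p % 5 = 2 ∧ 2 < p :=
  ⟨2 ^ 2203 - 1, prime_2203, by norm_num, by norm_num, by norm_num⟩

theorem binom_aux (y : ℤ) (N : ℕ) :
    ∃ c : ℤ, (y + 1) ^ N = 1 + N * y + y ^ 2 * c ∧ (0 ≤ y → 0 ≤ c) := by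
  induction N with
  | zero => exact ⟨0, by simp, by simp⟩
  | succ N ih =>
    obtain ⟨c, hc, h0⟩ := ih
    refine ⟨N + c * (y + 1), ?_, fun hy => ?_⟩
    · rw [pow_succ, hc]; push_cast; ring
    · have := h0 hy
      positivity

/-- The arithmetic core: `y` is determined. -/
theorem y_eq (N : ℕ) (p : ℕ) (hp : p.Prime) (hN : N = p + 1) (hp5 : p % 5 = 2)
    (y t z : ℤ) (hy : y = 5 * t + 2) (h : y * y * z + (y + 1) = (y + 1) ^ N) :
    y = p := by
  obtain ⟨c, hc, -⟩ := binom_aux y N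
  have hy0 : y ≠ 0 := by omega
  have h1 : y * (y * (z - c)) = y * (p : ℤ) := by
    rw [hc, hN] at h
    push_cast at h
    linear_combination h
  have h2 : y * (z - c) = p := mul_left_cancel₀ hy0 h1
  have h3 : y.natAbs ∣ p := by
    have : y ∣ (p : ℤ) := ⟨_, h2.symm⟩
    simpa using Int.natAbs_dvd_natAbs.mpr this
  rcases (Nat.dvd_prime hp).mp h3 with h4 | h4 <;> omega

/-- Powers in the squaring chain. -/
theorem chain_pow (n : ℕ) (x : ℕ → ℤ) (h : ∀ i, 1 ≤ i → i ≤ n → x i * x i = x (i + 1)) :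
    ∀ i, i ≤ n → x (i + 1) = x 1 ^ (2 ^ i) := by
  intro i
  induction i with
  | zero => intro _; simp
  | succ i ih =>
    intro hi
    rw [← h (i + 1) (by omega) hi, ih (by omega), pow_succ 2 i, pow_mul, sq]

/-- The nontrivial solution. -/
def solA (n : ℕ) (y t z : ℤ) (i : ℕ) : ℤ :=
  if i ≤ n + 1 then (y + 1) ^ (2 ^ (i - 1))
  else if i = n + 2 then t
  else if i = n + 3 then 2 * t
  else if i = n + 4 then 4 * t
  else if i = n + 5 then 5 * t
  else if i = n + 6 then 1
  else if i = n + 7 then 5 * t + 1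
  else if i = n + 8 then y
  else if i = n + 9 then y * y
  else if i = n + 10 then z
  else y * y * z

theorem solA_solves (n : ℕ) (hn : 2203 ≤ n) (y t z : ℤ) (hy : y = 5 * t + 2)
    (h : y * y * z + (y + 1) = (y + 1) ^ (2 ^ 2203)) : SolvesT' n (solA n y t z) := by
  have h1 : solA n y t z 1 = y + 1 := by simp [solA]
  have h6 : solA n y t z (n + 6) = 1 := by simp [solA]
  have h8 : solA n y t z (n + 8) = y := by simp [solA]
  have h9 : solA n y t z (n + 9) = y * y := by simp [solA]
  have h10 : solA n y t z (n + 10) = z := by simp [solA]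
  have h11 : solA n y t z (n + 11) = y * y * z := by simp [solA]
  have hbig : solA n y t z 2204 = (y + 1) ^ (2 ^ 2203) := by
    unfold solA
    rw [if_pos (by omega), show 2204 - 1 = 2203 from rfl]
  refine ⟨?_, ?_, ?_, ?_, ?_, ?_, ?_, ?_, ?_, ?_, ?_⟩
  · intro i hi hin
    obtain ⟨j, rfl⟩ : ∃ j, i = j + 1 := ⟨i - 1, by omega⟩
    unfold solA
    rw [if_pos (by omega), if_pos (by omega)]
    simp only [Nat.add_sub_cancel]
    rw [pow_succ 2 j, pow_mul, sq]
  · simp [solA]; ring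
  · simp [solA]; ring
  · simp [solA]; ring
  · intro i _ _; rw [h6, one_mul]
  · simp [solA]
  · simp [solA]; rw [hy]; ring
  · rw [h8, h6, h1]
  · rw [h8, h9]
  · rw [h9, h10, h11]
  · rw [h11, h1, hbig]; exact h

theorem solA_unique (n : ℕ) (hn : 2203 ≤ n) (p : ℕ) (hp : p.Prime) (hN : 2 ^ 2203 = p + 1)
    (hp5 : p % 5 = 2) (y t z : ℤ) (hyp : y = p) (hy : y = 5 * t + 2)
    (h : y * y * z + (y + 1) = (y + 1) ^ (2 ^ 2203)) (b : ℕ → ℤ) (hb : SolvesT' n b) :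
    (∀ i, 1 ≤ i → i ≤ n + 11 → b i = 0) ∨
      (∀ i, 1 ≤ i → i ≤ n + 11 → b i = solA n y t z i) := by
  obtain ⟨hsq, e3, e4, e5, hone, e7, e8, e1, e9, e11, elast⟩ := hb
  by_cases h6 : b (n + 6) = 1
  · right
    have hch := chain_pow n b hsq
    have hbig : b 2204 = b 1 ^ (2 ^ 2203) := hch 2203 hn
    have h8 : b (n + 8) = 5 * b (n + 2) + 2 := by linarith
    have h1 : b 1 = b (n + 8) + 1 := by linarith
    have heq : b (n + 8) * b (n + 8) * b (n + 10) + (b (n + 8) + 1)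
        = (b (n + 8) + 1) ^ (2 ^ 2203) := by
      rw [e9, e11, ← h1, elast, hbig]
    have hY : b (n + 8) = y := by
      rw [hyp]
      exact y_eq _ p hp hN hp5 _ _ _ h8 heq
    have ht : b (n + 2) = t := by linarith
    have hy0 : y ≠ 0 := by omega
    have hz : b (n + 10) = z := by
      rw [hY, ← h] at heq
      have := add_right_cancel heq
      exact mul_left_cancel₀ (mul_ne_zero hy0 hy0) this
    intro i hi hi'
    by_cases hin : i ≤ n + 1
    · obtain ⟨j, rfl⟩ : ∃ j, i = j + 1 := ⟨i - 1, by omega⟩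
      unfold solA
      rw [if_pos hin, hch j (by omega), h1, hY]
      rfl
    · obtain ⟨d, rfl⟩ : ∃ d, i = n + d := ⟨i - n, by omega⟩
      have hd : d ≤ 11 := by omega
      have hd' : 2 ≤ d := by omega
      rw [hY] at e9
      rw [← e9, hz] at e11
      interval_cases d <;> simp [solA] <;> linarith
  · left
    have h0 : b (n + 6) = 0 := by
      have := hone (n + 6) (by omega) (by omega)
      by_contra h0
      exact h6 (mul_left_cancel₀ h0 (by rw [this, mul_one]))
    intro i hi hi'
    rw [← hone i hi hi', h0, zero_mul]

theorem solA_pos (n : ℕ) (y t z : ℤ) (hy : 0 < y) (ht : 0 < t) (hz : 0 < z) (i : ℕ) :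
    0 < solA n y t z i := by
  unfold solA
  split_ifs <;> positivity

theorem solA_large (n : ℕ) (y t z : ℤ) (hy : y + 1 = 2 ^ 2203) :
    (2 : ℤ) ^ (2 ^ (n + 11)) < solA n y t z (n + 1) := by
  unfold solA
  rw [if_pos le_rfl, hy, ← pow_mul]
  apply pow_lt_pow_right₀ (by norm_num)
  have : 0 < 2 ^ n := by positivity
  rw [pow_add, Nat.add_sub_cancel]
  omega

theorem transfer (n : ℕ) (hn : 2203 ≤ n) (a b : ℕ → ℤ) (ha : SolvesT' n a)
    (hadd : ∀ i j k, 1 ≤ i → i ≤ n + 11 → 1 ≤ j → j ≤ n + 11 → 1 ≤ k → k ≤ n + 11 →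
      a i + a j = a k → b i + b j = b k)
    (hmul : ∀ i j k, 1 ≤ i → i ≤ n + 11 → 1 ≤ j → j ≤ n + 11 → 1 ≤ k → k ≤ n + 11 →
      a i * a j = a k → b i * b j = b k) : SolvesT' n b := by
  obtain ⟨hsq, e3, e4, e5, hone, e7, e8, e1, e9, e11, elast⟩ := ha
  refine ⟨fun i hi hi' => ?_, ?_, ?_, ?_, fun i hi hi' => ?_, ?_, ?_, ?_, ?_, ?_, ?_⟩
  · exact hmul _ _ _ (by omega) (by omega) (by omega) (by omega) (by omega) (by omega)
      (hsq i hi hi')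
  · exact hadd _ _ _ (by omega) (by omega) (by omega) (by omega) (by omega) (by omega) e3
  · exact hadd _ _ _ (by omega) (by omega) (by omega) (by omega) (by omega) (by omega) e4
  · exact hadd _ _ _ (by omega) (by omega) (by omega) (by omega) (by omega) (by omega) e5
  · exact hmul _ _ _ (by omega) (by omega) (by omega) (by omega) (by omega) (by omega)
      (hone i hi hi')
  · exact hadd _ _ _ (by omega) (by omega) (by omega) (by omega) (by omega) (by omega) e7
  · exact hadd _ _ _ (by omega) (by omega) (by omega) (by omega) (by omega) (by omega) e8
  · exact hadd _ _ _ (by omega) (by omega) (by omega) (by omega) (by omega) (by omega) e1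
  · exact hmul _ _ _ (by omega) (by omega) (by omega) (by omega) (by omega) (by omega) e9
  · exact hmul _ _ _ (by omega) (by omega) (by omega) (by omega) (by omega) (by omega) e11
  · exact hadd _ _ _ (by omega) (by omega) (by omega) (by omega) (by omega) (by omega) elast

theorem first_part (n : ℕ) (hn : 2203 ≤ n) :
    ∃ a : ℕ → ℤ,
      SolvesT' n a ∧
      (∀ i, 1 ≤ i → i ≤ n + 11 → 0 < a i) ∧
      (∃ i, 1 ≤ i ∧ i ≤ n + 11 ∧ (2 : ℤ) ^ (2 ^ (n + 11)) < a i) ∧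
      SolvesT' n (fun _ => 0) ∧
      (∀ b : ℕ → ℤ, SolvesT' n b →
        (∀ i, 1 ≤ i → i ≤ n + 11 → b i = 0) ∨ (∀ i, 1 ≤ i → i ≤ n + 11 → b i = a i)) := by
  obtain ⟨p, hp, hN, hp5, hpbig⟩ := exists_p
  obtain ⟨c, hc, hc0⟩ := binom_aux (p : ℤ) (2 ^ 2203)
  have hc0 := hc0 (Int.natCast_nonneg p)
  obtain ⟨t, ht⟩ : ∃ t : ℤ, (p : ℤ) = 5 * t + 2 := ⟨(p : ℤ) / 5, by omega⟩
  have h : (p : ℤ) * p * (1 + c) + (p + 1) = (p + 1) ^ (2 ^ 2203) := by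
    rw [hc, hN]
    push_cast
    ring
  refine ⟨solA n p t (1 + c), solA_solves n hn _ _ _ ht h, fun i _ _ => ?_,
    ⟨n + 1, by omega, by omega, ?_⟩, ?_, ?_⟩
  · exact solA_pos _ _ _ _ (by omega) (by omega) (by omega) i
  · apply solA_large
    exact_mod_cast hN.symm
  · simp [SolvesT']
  · exact solA_unique n hn p hp hN hp5 _ _ _ rfl ht h

theorem stmt_2 (n : ℕ) (hn : 2203 ≤ n) :
    (∃ a : ℕ → ℤ,
      SolvesT' n a ∧
      (∀ i, 1 ≤ i → i ≤ n + 11 → 0 < a i) ∧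
      (∃ i, 1 ≤ i ∧ i ≤ n + 11 ∧ (2 : ℤ) ^ (2 ^ (n + 11)) < a i) ∧
      SolvesT' n (fun _ => 0) ∧
      (∀ b : ℕ → ℤ, SolvesT' n b →
        (∀ i, 1 ≤ i → i ≤ n + 11 → b i = 0) ∨ (∀ i, 1 ≤ i → i ≤ n + 11 → b i = a i))) ∧
    (∃ S : Set (AMEqn (n + 11)),
      {x : Fin (n + 11) → ℤ | ∀ e ∈ S, e.Holds x}.Finite ∧
      ∃ x : Fin (n + 11) → ℤ, (∀ e ∈ S, e.Holds x) ∧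
        ∃ i, (2 : ℤ) ^ (2 ^ (n + 11)) < x i) := by
  refine ⟨first_part n hn, ?_⟩
  obtain ⟨a, ha, -, ⟨m, hm1, hm2, hm⟩, -, huniq⟩ := first_part n hn
  refine ⟨{e | e.Holds (fun i : Fin (n + 11) => a (i + 1))}, ?_,
    fun i => a (i + 1), fun e he => he, ⟨m - 1, by omega⟩, ?_⟩
  · apply Set.Finite.subset
      (Set.toFinite {(fun _ => 0 : Fin (n + 11) → ℤ), fun i : Fin (n + 11) => a (i + 1)})
    intro x hx
    let b : ℕ → ℤ := fun i => if h : i - 1 < n + 11 then x ⟨i - 1, h⟩ else 0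
    have hbx : ∀ i, 1 ≤ i → ∀ hi : i ≤ n + 11, b i = x ⟨i - 1, by omega⟩ := by
      intro i h1 hi
      have : i - 1 < n + 11 := by omega
      simp only [b, dif_pos this]
    have hbi : ∀ i : Fin (n + 11), x i = b (i + 1) := by
      intro i
      simp [b]
    have hsol : SolvesT' n b := by
      apply transfer n hn a b ha
      · intro i j k hi hi' hj hj' hk hk' hh
        rw [hbx i hi hi', hbx j hj hj', hbx k hk hk']
        refine hx (.add ⟨i - 1, by omega⟩ ⟨j - 1, by omega⟩ ⟨k - 1, by omega⟩) ?_
        simp only [Set.mem_ofPred_eq, AMEqn.Holds]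
        rw [Nat.sub_add_cancel hi, Nat.sub_add_cancel hj, Nat.sub_add_cancel hk]
        exact hh
      · intro i j k hi hi' hj hj' hk hk' hh
        rw [hbx i hi hi', hbx j hj hj', hbx k hk hk']
        refine hx (.mul ⟨i - 1, by omega⟩ ⟨j - 1, by omega⟩ ⟨k - 1, by omega⟩) ?_
        simp only [Set.mem_ofPred_eq, AMEqn.Holds]
        rw [Nat.sub_add_cancel hi, Nat.sub_add_cancel hj, Nat.sub_add_cancel hk]
        exact hh
    rcases huniq b hsol with h | h
    · left
      funext i
      rw [hbi, h _ (by omega) (by omega)]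
    · right
      simp only [Set.mem_singleton_iff]
      funext i
      rw [hbi, h _ (by omega) (by omega)]
  · simp only [Nat.sub_add_cancel hm1]
    exact hm
end

section
/- For each positive integer n, the system of equations in the variables x_1,...,x_{n+10} consisting of: x_i · x_i = x_{i+1} for all i ∈ {1,...,n}; x_1 · x_{n+1} = x_{n+2}; x_{n+3} = 1; x_{n+3} + x_{n+3} = x_{n+4}; x_{n+4} + x_{n+4} = x_{n+5}; x_{n+5} + x_{n+3} = x_1; x_{n+6} · x_{n+6} = x_{n+7}; x_{n+8} · x_{n+8} = x_{n+9}; x_{n+9} + x_{n+3} = x_{n+10}; x_{n+2} · x_{n+7} = x_{n+10}, has infinitely many solutions in non-negative integers x_1,...,x_{n+10}; moreover, every integer tuple (x_1,...,x_{n+10}) solving the system satisfies x_{n+10} ≥ (((2+√5)^(5^(2^(n−1))) + (2−√5)^(5^(2^(n−1))))/2)² + 1. -/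
/-- The system from Theorem 4, in variables `x 1, ..., x (n+10)`, over any
commutative semiring (we use it over ℕ and over ℤ). -/
def Solves7 {R : Type*} [CommSemiring R] (n : ℕ) (x : ℕ → R) : Prop :=
  (∀ i, 1 ≤ i → i ≤ n → x i * x i = x (i + 1)) ∧
  x 1 * x (n + 1) = x (n + 2) ∧
  x (n + 3) = 1 ∧
  x (n + 3) + x (n + 3) = x (n + 4) ∧
  x (n + 4) + x (n + 4) = x (n + 5) ∧
  x (n + 5) + x (n + 3) = x 1 ∧
  x (n + 6) * x (n + 6) = x (n + 7) ∧
  x (n + 8) * x (n + 8) = x (n + 9) ∧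
  x (n + 9) + x (n + 3) = x (n + 10) ∧
  x (n + 2) * x (n + 7) = x (n + 10)

/-- The pair (y, w) with y + w√5 = (2 + √5)^k. -/
def pellP : ℕ → ℕ × ℕ
  | 0 => (1, 0)
  | k + 1 => (2 * (pellP k).1 + 5 * (pellP k).2, (pellP k).1 + 2 * (pellP k).2)

def pY (k : ℕ) : ℕ := (pellP k).1
def pW (k : ℕ) : ℕ := (pellP k).2

lemma pY_zero : pY 0 = 1 := rfl
lemma pW_zero : pW 0 = 0 := rfl
lemma pY_succ (k : ℕ) : pY (k + 1) = 2 * pY k + 5 * pW k := rfl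
lemma pW_succ (k : ℕ) : pW (k + 1) = pY k + 2 * pW k := rfl

lemma p_add (a b : ℕ) : pY (a + b) = pY a * pY b + 5 * (pW a * pW b) ∧
    pW (a + b) = pY a * pW b + pW a * pY b := by
  induction b with
  | zero => simp [pY_zero, pW_zero]
  | succ b ih =>
    rw [← add_assoc, pY_succ, pW_succ, pY_succ, pW_succ, ih.1, ih.2]
    constructor <;> ring

lemma p_norm (k : ℕ) : (pY k : ℤ) ^ 2 - 5 * (pW k : ℤ) ^ 2 = (-1) ^ k := by
  induction k with
  | zero => simp [pY_zero, pW_zero]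
  | succ k ih =>
    rw [pY_succ, pW_succ, pow_succ (-1 : ℤ), ← ih]; push_cast; ring

lemma pY_pos (k : ℕ) : 0 < pY k := by
  induction k with
  | zero => simp [pY_zero]
  | succ k ih => rw [pY_succ]; omega

lemma pY_mono : StrictMono pY :=
  strictMono_nat_of_lt_succ fun k => by have := pY_pos k; rw [pY_succ]; omega

lemma p_five (j : ℕ) : pW (5 * j) =
    5 * (pW j * (pY j ^ 4 + 10 * pY j ^ 2 * pW j ^ 2 + 5 * pW j ^ 4)) := by
  have h : 5 * j = j + j + j + j + j := by ring
  rw [h]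
  simp only [(p_add _ _).1, (p_add _ _).2]
  ring

lemma p_class (w : ℕ) : ∀ y : ℕ, ((y : ℤ) ^ 2 - 5 * (w : ℤ) ^ 2 = 1 ∨
    (y : ℤ) ^ 2 - 5 * (w : ℤ) ^ 2 = -1) → ∃ k, y = pY k ∧ w = pW k := by
  induction w using Nat.strong_induction_on with
  | _ w ih =>
    intro y h
    rcases Nat.eq_zero_or_pos w with rfl | hw
    · refine ⟨0, ?_, rfl⟩
      rw [pY_zero]
      rcases h with h | h
      · have : (y : ℤ) = 1 := by push_cast at h; nlinarith
        exact_mod_cast this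
      · push_cast at h; nlinarith
    · have hw' : (1 : ℤ) ≤ w := by exact_mod_cast hw
      have h0 : (0 : ℤ) ≤ y := by positivity
      have h1 : 2 * (w : ℤ) ≤ y := by
        by_contra hc; push Not at hc; rcases h with h | h <;> nlinarith
      have h2 : 2 * (y : ℤ) ≤ 5 * w := by
        by_contra hc; push Not at hc; rcases h with h | h <;> nlinarith
      have h3 : (y : ℤ) < 3 * w := by
        by_contra hc; push Not at hc; rcases h with h | h <;> nlinarith
      obtain ⟨a, ha⟩ : ∃ a : ℕ, (a : ℤ) = 5 * w - 2 * y := ⟨5 * w - 2 * y, by omega⟩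
      obtain ⟨b, hb⟩ : ∃ b : ℕ, (b : ℤ) = y - 2 * w := ⟨y - 2 * w, by omega⟩
      obtain ⟨k, hk1, hk2⟩ := ih b (by omega) a (by
        rw [ha, hb]
        rcases h with h | h
        · right; linarith
        · left; linarith)
      refine ⟨k + 1, ?_, ?_⟩
      · rw [pY_succ]; omega
      · rw [pW_succ]; omega

lemma p_dvd_five (k : ℕ) : 5 ∣ pW k → 5 ∣ k := by
  induction k using Nat.strong_induction_on with
  | _ k ih =>
    intro h
    by_cases hk : k < 5
    · interval_cases k <;> revert h <;> decide
    · obtain ⟨j, rfl⟩ : ∃ j, k = j + 5 := ⟨k - 5, by omega⟩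
      have h5 : pW (j + 5) = 305 * pY j + 682 * pW j := by
        simp only [pW_succ, pY_succ]; ring
      have := ih j (by omega) (by omega)
      omega

lemma p_factor (j : ℕ) :
    Nat.Coprime 5 (pY j ^ 4 + 10 * pY j ^ 2 * pW j ^ 2 + 5 * pW j ^ 4) := by
  rw [Nat.Prime.coprime_iff_not_dvd Nat.prime_five]
  intro h
  have h1 : 5 ∣ pY j ^ 4 := by
    have e : pY j ^ 4 + 10 * pY j ^ 2 * pW j ^ 2 + 5 * pW j ^ 4 =
      pY j ^ 4 + 5 * (2 * pY j ^ 2 * pW j ^ 2 + pW j ^ 4) := by ring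
    rw [e] at h
    exact (Nat.dvd_add_left (Dvd.intro _ rfl)).1 h
  obtain ⟨c, hc⟩ := Nat.prime_five.dvd_of_dvd_pow h1
  have hn := p_norm j
  rw [hc] at hn
  push_cast at hn
  have : (5 : ℤ) ∣ (-1) ^ j := ⟨5 * c ^ 2 - pW j ^ 2, by rw [← hn]; ring⟩
  rcases neg_one_pow_eq_or ℤ j with h | h <;> rw [h] at this <;> omega

lemma p_dvd (m : ℕ) : ∀ k, 5 ^ m ∣ pW k ↔ 5 ^ m ∣ k := by
  induction m with
  | zero => simp
  | succ m ih =>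
    intro k
    have key : ∀ j, 5 ^ (m + 1) ∣ pW (5 * j) ↔ 5 ^ (m + 1) ∣ 5 * j := by
      intro j
      rw [p_five, pow_succ', Nat.mul_dvd_mul_iff_left (by norm_num),
        Nat.mul_dvd_mul_iff_left (by norm_num), ← ih j]
      exact ⟨fun h => (Nat.Coprime.pow_left m (p_factor j)).dvd_of_dvd_mul_right h,
        fun h => Dvd.dvd.mul_right h _⟩
    have h5 : 5 ∣ 5 ^ (m + 1) := Dvd.intro_left _ rfl
    constructor
    · intro h
      obtain ⟨j, rfl⟩ := p_dvd_five k (h5.trans h)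
      exact (key j).1 h
    · intro h
      obtain ⟨j, rfl⟩ := h5.trans h
      exact (key j).2 h

lemma p_real (k : ℕ) : (2 + Real.sqrt 5) ^ k = pY k + pW k * Real.sqrt 5 ∧
    (2 - Real.sqrt 5) ^ k = pY k - pW k * Real.sqrt 5 := by
  have hs : Real.sqrt 5 * Real.sqrt 5 = 5 := Real.mul_self_sqrt (by norm_num)
  induction k with
  | zero => simp [pY_zero, pW_zero]
  | succ k ih =>
    rw [pow_succ, pow_succ, ih.1, ih.2, pY_succ, pW_succ]; push_cast
    constructor <;> linear_combination (pW k : ℝ) * hs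

/-- The solution with given y, z. -/
def solX (n y z : ℕ) : ℕ → ℕ := fun i =>
  if i ≤ n + 1 then 5 ^ 2 ^ (i - 1)
  else match i - n with
    | 2 => 5 ^ (2 ^ n + 1)
    | 3 => 1
    | 4 => 2
    | 5 => 4
    | 6 => z
    | 7 => z * z
    | 8 => y
    | 9 => y * y
    | _ => y * y + 1

lemma solX_solves (n y z : ℕ) (hn : 0 < n) (h : 5 ^ (2 ^ n + 1) * (z * z) = y * y + 1) :
    Solves7 n (solX n y z) := by
  have e1 : solX n y z 1 = 5 := by simp [solX]
  refine ⟨?_, ?_, ?_, ?_, ?_, ?_, ?_, ?_, ?_, ?_⟩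
  · intro i h1 h2
    obtain ⟨j, rfl⟩ : ∃ j, i = j + 1 := ⟨i - 1, by omega⟩
    simp only [solX]
    rw [if_pos (by omega), if_pos (by omega)]
    simp only [Nat.add_sub_cancel]
    rw [← pow_add]; congr 1; ring
  · rw [e1]; simp [solX]; ring
  all_goals simp [solX, h]
 
theorem stmt_7 (n : ℕ) (hn : 0 < n) :
    -- infinitely many solutions (x_1, ..., x_{n+10}) in non-negative integers
    ((fun x : ℕ → ℕ => fun i : Fin (n + 10) => x (i.1 + 1)) ''
      {x : ℕ → ℕ | Solves7 n x}).Infinite ∧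
    -- every integer tuple solving the system satisfies the lower bound
    (∀ x : ℕ → ℤ, Solves7 n x →
      (((2 + Real.sqrt 5) ^ 5 ^ 2 ^ (n - 1) + (2 - Real.sqrt 5) ^ 5 ^ 2 ^ (n - 1)) / 2) ^ 2
        + 1 ≤ (x (n + 10) : ℝ)) := by
  obtain ⟨m, hm⟩ : ∃ m, m = 2 ^ (n - 1) := ⟨_, rfl⟩
  have hm2 : 2 ^ n = 2 * m := by
    obtain ⟨j, rfl⟩ : ∃ j, n = j + 1 := ⟨n - 1, by omega⟩
    rw [hm, Nat.add_sub_cancel]; ring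
  rw [← hm]
  constructor
  · let K : ℕ → ℕ := fun l => 5 ^ m * (2 * l + 1)
    refine Set.infinite_of_injective_forall_mem
      (f := fun l : ℕ => fun i : Fin (n + 10) =>
        solX n (pY (K l)) (pW (K l) / 5 ^ m) (i.1 + 1)) ?_ ?_
    · intro a b hab
      have h := congrFun hab ⟨n + 7, by omega⟩
      have e : ∀ y z, solX n y z (n + 7 + 1) = y := by intro y z; simp [solX, add_assoc]
      simp only [e] at h
      have := pY_mono.injective h
      have := Nat.eq_of_mul_eq_mul_left (by positivity) this
      omega
    · intro l
      refine ⟨_, solX_solves n _ _ hn ?_, rfl⟩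
      obtain ⟨z, hz⟩ := (p_dvd m (K l)).2 (Dvd.intro _ rfl)
      have hnorm := p_norm (K l)
      have hodd : Odd (K l) := by
        apply Odd.mul
        · exact Odd.pow (by decide)
        · exact ⟨l, rfl⟩
      rw [hodd.neg_one_pow, hz] at hnorm
      rw [hz, Nat.mul_div_cancel_left _ (by positivity), hm2]
      zify
      push_cast at hnorm
      have e : (5 : ℤ) ^ (2 * m + 1) = 5 * (5 ^ m) ^ 2 := by rw [pow_succ, mul_comm 2 m, pow_mul]; ring
      rw [e]
      linarith
  · rintro x ⟨h1, h2, h3, h4, h5, h6, h7, h8, h9, h10⟩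
    have hx1 : x 1 = 5 := by omega
    have hp : ∀ i, i ≤ n → x (i + 1) = 5 ^ 2 ^ i := by
      intro i
      induction i with
      | zero => intro _; simpa using hx1
      | succ i ih =>
        intro hi
        rw [← h1 (i + 1) (by omega) hi, ih (by omega), ← pow_add]; congr 1; ring
    have e : (5 : ℤ) ^ (2 ^ n) = (5 ^ m) ^ 2 := by rw [hm2, mul_comm 2 m, pow_mul]
    rw [hp n le_rfl, hx1, e] at h2
    rw [← h2, ← h7, ← h9, ← h8, h3] at h10
    obtain ⟨k, hk1, hk2⟩ := p_class (5 ^ m * (x (n + 6)).natAbs) (x (n + 8)).natAbs (by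
      right
      push_cast
      rw [mul_pow, sq_abs, sq_abs]
      linarith)
    have hd : 5 ^ m ∣ k := (p_dvd m k).1 ⟨_, hk2.symm⟩
    have hk0 : 0 < k := by
      rcases Nat.eq_zero_or_pos k with rfl | h
      · rw [pW_zero] at hk2
        have : (x (n + 6)).natAbs = 0 := by
          rcases Nat.mul_eq_zero.1 hk2 with h | h
          · exact absurd h (by positivity)
          · exact h
        rw [Int.natAbs_eq_zero.1 this] at h10
        nlinarith
      · exact h
    have hle := pY_mono.monotone (Nat.le_of_dvd hk0 hd)
    rw [← hk1] at hle
    rw [(p_real _).1, (p_real _).2, ← h9, ← h8, h3]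
    have hr : ((pY (5 ^ m) : ℕ) : ℝ) ≤ |(x (n + 8) : ℝ)| := by
      have : ((pY (5 ^ m) : ℕ) : ℤ) ≤ |x (n + 8)| := by rw [Int.abs_eq_natAbs]; exact_mod_cast hle
      exact_mod_cast this
    have := pow_le_pow_left₀ (by positivity) hr 2
    rw [sq_abs] at this
    push_cast
    ring_nf at this ⊢
    linarith
end
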